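/- Under Assumption 1 (F is μ_F-strongly convex and L_F-smooth, G is μ_G-strongly convex and L_G-smooth), let (x_k, y_k)_{k≥1} be iterates of the primal-dual scheme with step sizes r ≤ 1/L_F, s ≤ 1/L_G, θ = min{√(μ_F r), √(μ_G s)}, and x_1 = x_0, y_1 = y_0, and let (x*, y*) be the unique saddle point of L. Then for every k ≥ 1: ‖x_k − x*‖² + ‖y_k − y*‖² ≤ (2 E_1 / min{μ_F, μ_G}) · (1 − θ)^{k−1}, where E_1 = L(x_1, y*) − L(x*, y_1) + (θ²/(2r))‖x_1 − x*‖² + (θ²/(2s))‖y_1 − y*‖². -/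

import Mathlib

open scoped RealInnerProductSpace

section GradientLemmas

variable {E : Type*} [NormedAddCommGroup E] [InnerProductSpace ℝ E]

/-- The descent lemma: a function with `C`-Lipschitz gradient lies below its quadratic model. -/
theorem le_quadratic_of_lipschitz_gradient [CompleteSpace E] {f : E → ℝ} {f' : E → E} {C : ℝ}
    (hf : ∀ z, HasGradientAt f (f' z) z) (hC : ∀ a b, ‖f' b - f' a‖ ≤ C * ‖b - a‖) (a b : E) :
    f b ≤ f a + ⟪f' a, b - a⟫ + C / 2 * ‖b - a‖ ^ 2 := by
  have hline : ∀ t : ℝ, HasDerivAt (fun t : ℝ => a + t • (b - a)) (b - a) t := fun t => by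
    simpa using ((hasDerivAt_id t).smul_const (b - a)).const_add a
  have hderiv : ∀ t : ℝ, HasDerivAt
      (fun t : ℝ => f (a + t • (b - a)) - (t * ⟪f' a, b - a⟫ + t ^ 2 * (C / 2 * ‖b - a‖ ^ 2)))
      (⟪f' (a + t • (b - a)), b - a⟫ - (⟪f' a, b - a⟫ + t * (C * ‖b - a‖ ^ 2))) t := fun t => by
    have h₁ := (hf (a + t • (b - a))).hasFDerivAt.comp_hasDerivAt t (hline t)
    have h₂ := ((hasDerivAt_id t).mul_const ⟪f' a, b - a⟫).add
      (((hasDerivAt_id t).pow 2).mul_const (C / 2 * ‖b - a‖ ^ 2))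
    refine (h₁.sub h₂).congr_deriv ?_
    simp
    ring
  have hanti : AntitoneOn
      (fun t : ℝ => f (a + t • (b - a)) - (t * ⟪f' a, b - a⟫ + t ^ 2 * (C / 2 * ‖b - a‖ ^ 2)))
      (Set.Icc 0 1) := by
    refine antitoneOn_of_deriv_nonpos (convex_Icc 0 1)
      (fun t _ => (hderiv t).continuousAt.continuousWithinAt)
      (fun t _ => (hderiv t).differentiableAt.differentiableWithinAt) fun t ht => ?_
    rw [interior_Icc] at ht
    rw [(hderiv t).deriv]
    have hlip := hC a (a + t • (b - a))
    rw [add_sub_cancel_left, norm_smul, Real.norm_of_nonneg ht.1.le] at hlip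
    have hcs := real_inner_le_norm (f' (a + t • (b - a)) - f' a) (b - a)
    rw [inner_sub_left] at hcs
    nlinarith [mul_le_mul_of_nonneg_right hlip (norm_nonneg (b - a))]
  have h := hanti (Set.left_mem_Icc.2 zero_le_one) (Set.right_mem_Icc.2 zero_le_one) zero_le_one
  simp only [one_smul, add_sub_cancel, zero_smul, add_zero] at h
  linarith

/-- Quadratic growth of a linearly tilted strongly convex function around its minimiser. -/
theorem quadratic_growth_of_isMin [CompleteSpace E] {f : E → ℝ} {f' : E → E} {μ : ℝ} {p x₀ : E}
    (hf : ∀ z, HasGradientAt f (f' z) z)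
    (hsc : ∀ a b, f b ≥ f a + ⟪f' a, b - a⟫ + μ / 2 * ‖b - a‖ ^ 2)
    (hmin : ∀ z, f x₀ + ⟪p, x₀⟫ ≤ f z + ⟪p, z⟫) (z : E) :
    f x₀ + ⟪p, x₀⟫ + μ / 2 * ‖z - x₀‖ ^ 2 ≤ f z + ⟪p, z⟫ := by
  have hloc : IsLocalMin (fun z => f z + ⟪p, z⟫) x₀ := Filter.Eventually.of_forall hmin
  have hzero := hloc.hasFDerivAt_eq_zero
    ((hf x₀).hasFDerivAt.add (innerSL ℝ p).hasFDerivAt)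
  have h := DFunLike.congr_fun hzero (z - x₀)
  simp [inner_sub_right] at h
  have h' := hsc x₀ z
  rw [inner_sub_right] at h'
  linarith

/-- A strong convexity modulus exceeding the Lipschitz constant of the gradient forces the space
to be trivial. -/
theorem eq_of_lipschitz_lt_strongConvex {f : E → ℝ} {f' : E → E} {μ C : ℝ}
    (hsc : ∀ a b, f b ≥ f a + ⟪f' a, b - a⟫ + μ / 2 * ‖b - a‖ ^ 2)
    (hC : ∀ a b, ‖f' b - f' a‖ ≤ C * ‖b - a‖) (hlt : C < μ) (a b : E) : a = b := by
  by_contra hne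
  have hpos : 0 < ‖b - a‖ := norm_pos_iff.2 (sub_ne_zero.2 (Ne.symm hne))
  have h₁ := hsc a b
  have h₂ := hsc b a
  have hcs := real_inner_le_norm (f' b - f' a) (b - a)
  rw [inner_sub_left] at hcs
  rw [← neg_sub b a, inner_neg_right, norm_neg] at h₂
  nlinarith [mul_le_mul_of_nonneg_right (hC a b) hpos.le, mul_pos (sub_pos.2 hlt) (pow_pos hpos 2)]

/-- The extrapolated point lies between the current iterate and the auxiliary point. -/
theorem extrapolation_eq {θ : ℝ} (hθ : 0 < θ) (x z : E) :
    x + ((1 - θ) / (1 + θ)) • (x - z) - x =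
      θ • (x + ((1 - θ) / θ) • (x - z) - (x + ((1 - θ) / (1 + θ)) • (x - z))) := by
  have : (1 - θ) / (1 + θ) = θ * ((1 - θ) / θ - (1 - θ) / (1 + θ)) := by
    field_simp
    ring
  rw [add_sub_cancel_left, add_sub_add_left_eq_sub, ← sub_smul, smul_smul, ← this]

theorem smul_extrapolation {θ : ℝ} (hθ : θ ≠ 0) (x z : E) :
    θ • (x + ((1 - θ) / θ) • (x - z)) = x - (1 - θ) • z := by
  rw [smul_add, smul_smul, mul_div_cancel₀ _ hθ]
  module

theorem add_smul_sub_eq {θ : ℝ} (hθ : θ ≠ 0) (x z : E) :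
    z + (1 / θ) • (x - z) = x + ((1 - θ) / θ) • (x - z) := by
  rw [sub_div, div_self hθ, sub_smul]
  module

/-- One step of Nesterov's accelerated gradient method with an extra forcing term `p` contracts the
Lyapunov function `f x + θ² / (2 r) * ‖v - x₀‖²`, up to the work done by `p`. -/
theorem accelerated_step [CompleteSpace E] {f : E → ℝ} {f' : E → E} {μ C r θ : ℝ}
    (hf : ∀ z, HasGradientAt f (f' z) z)
    (hsc : ∀ a b, f b ≥ f a + ⟪f' a, b - a⟫ + μ / 2 * ‖b - a‖ ^ 2)
    (hC : ∀ a b, ‖f' b - f' a‖ ≤ C * ‖b - a‖)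
    (hμ : 0 ≤ μ) (hr₀ : 0 < r) (hr : r * C ≤ 1) (hθ₀ : 0 < θ) (hθ₁ : θ ≤ 1) (hθ : θ ^ 2 ≤ μ * r)
    {x v w x₁ v₁ p : E} (x₀ : E) (hw : w - x = θ • (v - w)) (hx₁ : x₁ = w - r • (f' w + p))
    (hv₁ : θ • v₁ = x₁ - (1 - θ) • x) :
    f x₁ + θ ^ 2 / (2 * r) * ‖v₁ - x₀‖ ^ 2 ≤
      (1 - θ) * (f x + θ ^ 2 / (2 * r) * ‖v - x₀‖ ^ 2) + θ * f x₀ - θ * ⟪p, v₁ - x₀⟫ := by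
  have hdesc := le_quadratic_of_lipschitz_gradient hf hC w x₁
  have hscx := hsc w x
  have hsc₀ := hsc w x₀
  obtain ⟨a, rfl⟩ : ∃ a, v = w + a := ⟨v - w, by abel⟩
  obtain ⟨b, rfl⟩ : ∃ b, x₀ = w - b := ⟨w - x₀, by abel⟩
  obtain ⟨g, rfl⟩ : ∃ g, p = g - f' w := ⟨f' w + p, by abel⟩
  rw [add_sub_cancel_left] at hw
  obtain rfl : x = w - θ • a := by rw [← hw]; abel
  rw [add_sub_cancel] at hx₁
  subst hx₁
  obtain rfl : v₁ = w + ((1 - θ) • a - (r / θ) • g) := by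
    have : θ • v₁ = θ • (w + ((1 - θ) • a - (r / θ) • g)) := by
      rw [hv₁]
      simp only [smul_sub, smul_add, smul_smul, mul_div_cancel₀ _ hθ₀.ne']
      module
    exact smul_right_injective E hθ₀.ne' this
  have e₁ : w + ((1 - θ) • a - (r / θ) • g) - (w - b) = b + (1 - θ) • a - (r / θ) • g := by abel
  have e₂ : w + a - (w - b) = a + b := by abel
  have e₃ (u : E) : w - u - w = -u := by abel
  rw [e₁, e₂]
  rw [e₃] at hdesc hscx hsc₀
  simp only [← real_inner_self_eq_norm_sq, inner_add_left, inner_add_right, inner_sub_left,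
    inner_sub_right, inner_neg_left, inner_neg_right, real_inner_smul_left, real_inner_smul_right,
    real_inner_comm a b, real_inner_comm a g, real_inner_comm b g] at *
  have haa := real_inner_self_nonneg (x := a)
  have hbb := real_inner_self_nonneg (x := b)
  have hgg := real_inner_self_nonneg (x := g)
  have hdesc_slack : 0 ≤ (1 - r * C) * (r / 2 * ⟪g, g⟫) :=
    mul_nonneg (sub_nonneg.2 hr) (by positivity)
  have hsc_slack : 0 ≤ (1 - θ) * (μ / 2 * θ ^ 2 * ⟪a, a⟫) :=
    mul_nonneg (sub_nonneg.2 hθ₁) (by positivity)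
  have hconv_slack : 0 ≤ (1 - θ) * (θ ^ 2 / (2 * r) * θ * ⟪a, a⟫) :=
    mul_nonneg (sub_nonneg.2 hθ₁) (by positivity)
  have hrate_slack : 0 ≤ (μ * r - θ ^ 2) * (θ / (2 * r) * ⟪b, b⟫) :=
    mul_nonneg (sub_nonneg.2 hθ) (by positivity)
  have hscx' := mul_le_mul_of_nonneg_left hscx (sub_nonneg.2 hθ₁)
  have hsc₀' := mul_le_mul_of_nonneg_left hsc₀ hθ₀.le
  refine le_of_sub_nonneg ?_
  have key := add_nonneg (add_nonneg (add_nonneg hdesc_slack hsc_slack)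
    (add_nonneg hconv_slack hrate_slack)) (add_nonneg (sub_nonneg.2 hdesc)
    (add_nonneg (sub_nonneg.2 hscx') (sub_nonneg.2 hsc₀')))
  refine key.trans_eq ?_
  field_simp
  ring

end GradientLemmas

theorem stmt_3 {n m : ℕ} (F : EuclideanSpace ℝ (Fin n) → ℝ)
    (G : EuclideanSpace ℝ (Fin m) → ℝ)
    (F' : EuclideanSpace ℝ (Fin n) → EuclideanSpace ℝ (Fin n))
    (G' : EuclideanSpace ℝ (Fin m) → EuclideanSpace ℝ (Fin m))
    (μF μG LF LG r s θ : ℝ)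
    (A : EuclideanSpace ℝ (Fin n) →L[ℝ] EuclideanSpace ℝ (Fin m))
    (hFdiff : ∀ z, HasGradientAt F (F' z) z)
    (hGdiff : ∀ z, HasGradientAt G (G' z) z)
    (hμF : 0 < μF) (hμG : 0 < μG)
    (hFsc : ∀ a b, F b ≥ F a + ⟪F' a, b - a⟫ + μF / 2 * ‖b - a‖ ^ 2)
    (hGsc : ∀ a b, G b ≥ G a + ⟪G' a, b - a⟫ + μG / 2 * ‖b - a‖ ^ 2)
    (hFsm : ∀ a b, ‖F' b - F' a‖ ≤ LF * ‖b - a‖)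
    (hGsm : ∀ a b, ‖G' b - G' a‖ ≤ LG * ‖b - a‖)
    (hr0 : 0 < r) (hr : r ≤ 1 / LF) (hs0 : 0 < s) (hs : s ≤ 1 / LG)
    (hθ : θ = min (Real.sqrt (μF * r)) (Real.sqrt (μG * s)))
    (L : EuclideanSpace ℝ (Fin n) → EuclideanSpace ℝ (Fin m) → ℝ)
    (hL : ∀ p q, L p q = F p + ⟪A p, q⟫ - G q)
    (xstar : EuclideanSpace ℝ (Fin n)) (ystar : EuclideanSpace ℝ (Fin m))
    (hsaddle : ∀ p q, L xstar q ≤ L xstar ystar ∧ L xstar ystar ≤ L p ystar)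
    (x xbar : ℕ → EuclideanSpace ℝ (Fin n))
    (y ybar : ℕ → EuclideanSpace ℝ (Fin m))
    (hx1 : x 1 = x 0) (hy1 : y 1 = y 0)
    (hxbar : ∀ k, 1 ≤ k → xbar k = x k + ((1 - θ) / (1 + θ)) • (x k - x (k - 1)))
    (hybar : ∀ k, 1 ≤ k → ybar k = y k + ((1 - θ) / (1 + θ)) • (y k - y (k - 1)))
    (hxupd : ∀ k, 1 ≤ k → x (k + 1) = xbar k - r •
      (F' (xbar k) + (ContinuousLinearMap.adjoint A) (y k + (1 / θ) • (y (k + 1) - y k))))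
    (hyupd : ∀ k, 1 ≤ k → y (k + 1) = ybar k - s •
      (G' (ybar k) - A (x k + (1 / θ) • (x (k + 1) - x k))))
    (E1 : ℝ)
    (hE1 : E1 = L (x 1) ystar - L xstar (y 1)
      + θ ^ 2 / (2 * r) * ‖x 1 - xstar‖ ^ 2 + θ ^ 2 / (2 * s) * ‖y 1 - ystar‖ ^ 2)
    : ∀ k : ℕ, 1 ≤ k →
      ‖x k - xstar‖ ^ 2 + ‖y k - ystar‖ ^ 2 ≤
        2 * E1 / min μF μG * (1 - θ) ^ (k - 1) := by
  have hθF_pos : 0 < √(μF * r) := Real.sqrt_pos.2 (mul_pos hμF hr0)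
  have hθG_pos : 0 < √(μG * s) := Real.sqrt_pos.2 (mul_pos hμG hs0)
  have hθ₀ : 0 < θ := hθ ▸ lt_min hθF_pos hθG_pos
  have hθF : θ ^ 2 ≤ μF * r :=
    (Real.le_sqrt' hθ₀).1 (hθ ▸ min_le_left _ _)
  have hθG : θ ^ 2 ≤ μG * s :=
    (Real.le_sqrt' hθ₀).1 (hθ ▸ min_le_right _ _)
  have hLF : 0 < LF := one_div_pos.1 (hr0.trans_le hr)
  have hLG : 0 < LG := one_div_pos.1 (hs0.trans_le hs)
  have hrL : r * LF ≤ 1 := (le_div_iff₀ hLF).1 hr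
  have hsL : s * LG ≤ 1 := (le_div_iff₀ hLG).1 hs
  rcases lt_or_ge 1 θ with hθ₁ | hθ₁
  · have hx (a b : EuclideanSpace ℝ (Fin n)) : a = b :=
      eq_of_lipschitz_lt_strongConvex hFsc hFsm (by by_contra! h; nlinarith) a b
    have hy (a b : EuclideanSpace ℝ (Fin m)) : a = b :=
      eq_of_lipschitz_lt_strongConvex hGsc hGsm (by by_contra! h; nlinarith) a b
    intro k _
    rw [hx (x 1) xstar, hy (y 1) ystar] at hE1
    rw [hx (x k) xstar, hy (y k) ystar]
    simp [hE1]
  let v (k : ℕ) := x k + ((1 - θ) / θ) • (x k - x (k - 1))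
  let u (k : ℕ) := y k + ((1 - θ) / θ) • (y k - y (k - 1))
  let energy (k : ℕ) := L (x k) ystar - L xstar (y k) + θ ^ 2 / (2 * r) * ‖v k - xstar‖ ^ 2
    + θ ^ 2 / (2 * s) * ‖u k - ystar‖ ^ 2
  have hstep (k : ℕ) (hk : 1 ≤ k) : energy (k + 1) ≤ (1 - θ) * energy k := by
    have hstepF := accelerated_step (x := x k) (w := xbar k) (v := v k) (v₁ := v (k + 1))
      hFdiff hFsc hFsm hμF.le
      hr0 hrL hθ₀ hθ₁ hθF xstar
      (by simp only [v, hxbar k hk]; exact extrapolation_eq hθ₀ _ _) (hxupd k hk)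
      (by simp only [v, Nat.add_sub_cancel]; exact smul_extrapolation hθ₀.ne' _ _)
    have hstepG := accelerated_step (x := y k) (w := ybar k) (v := u k) (v₁ := u (k + 1))
      (x₁ := y (k + 1))
      (p := -A (x k + (1 / θ) • (x (k + 1) - x k))) hGdiff hGsc hGsm hμG.le
      hs0 hsL hθ₀ hθ₁ hθG ystar
      (by simp only [u, hybar k hk]; exact extrapolation_eq hθ₀ _ _)
      (by rw [hyupd k hk, sub_eq_add_neg (G' _)])
      (by simp only [u, Nat.add_sub_cancel]; exact smul_extrapolation hθ₀.ne' _ _)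
    have hv : x k + (1 / θ) • (x (k + 1) - x k) = v (k + 1) := by
      simp only [v, Nat.add_sub_cancel]; exact add_smul_sub_eq hθ₀.ne' _ _
    have hu : y k + (1 / θ) • (y (k + 1) - y k) = u (k + 1) := by
      simp only [u, Nat.add_sub_cancel]; exact add_smul_sub_eq hθ₀.ne' _ _
    have hx' : x (k + 1) = θ • v (k + 1) + (1 - θ) • x k := by
      simp only [v, Nat.add_sub_cancel]; rw [smul_extrapolation hθ₀.ne']; abel
    have hy' : y (k + 1) = θ • u (k + 1) + (1 - θ) • y k := by
      simp only [u, Nat.add_sub_cancel]; rw [smul_extrapolation hθ₀.ne']; abel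
    rw [hu, ContinuousLinearMap.adjoint_inner_left, map_sub, real_inner_comm] at hstepF
    rw [hv, inner_neg_left] at hstepG
    have hAx : ⟪A (x (k + 1)), ystar⟫ = θ * ⟪A (v (k + 1)), ystar⟫ + (1 - θ) * ⟪A (x k), ystar⟫ := by
      rw [hx', map_add, map_smul, map_smul, inner_add_left, real_inner_smul_left,
        real_inner_smul_left]
    have hAy : ⟪A xstar, y (k + 1)⟫ = θ * ⟪A xstar, u (k + 1)⟫ + (1 - θ) * ⟪A xstar, y k⟫ := by
      rw [hy', inner_add_right, real_inner_smul_right, real_inner_smul_right]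
    rw [inner_sub_left] at hstepF
    rw [inner_sub_right] at hstepG
    simp only [energy, hL, hAx, hAy]
    linear_combination hstepF + hstepG
  have hdecay (k : ℕ) (hk : 1 ≤ k) : energy k ≤ (1 - θ) ^ (k - 1) * E1 := by
    induction k, hk using Nat.le_induction with
    | base => simp [energy, v, u, hx1, hy1, hE1]
    | succ k hk ih =>
      obtain ⟨j, rfl⟩ := Nat.exists_eq_add_of_le' hk
      calc energy (j + 1 + 1) ≤ (1 - θ) * energy (j + 1) := hstep _ hk
        _ ≤ (1 - θ) * ((1 - θ) ^ (j + 1 - 1) * E1) :=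
          mul_le_mul_of_nonneg_left ih (sub_nonneg.2 hθ₁)
        _ = (1 - θ) ^ (j + 1 + 1 - 1) * E1 := by
          simp only [Nat.add_sub_cancel, pow_succ]; ring
  intro k hk
  have hgrowthF := quadratic_growth_of_isMin (p := (ContinuousLinearMap.adjoint A) ystar)
    (x₀ := xstar) hFdiff hFsc (fun z => by
      have h := (hsaddle z ystar).2
      rw [hL, hL] at h
      rw [ContinuousLinearMap.adjoint_inner_left, ContinuousLinearMap.adjoint_inner_left,
        real_inner_comm, real_inner_comm (A z)]
      linarith) (x k)
  have hgrowthG := quadratic_growth_of_isMin (p := -A xstar) (x₀ := ystar) hGdiff hGsc (fun z => by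
      have h := (hsaddle xstar z).1
      rw [hL, hL] at h
      rw [inner_neg_left, inner_neg_left]
      linarith) (y k)
  rw [ContinuousLinearMap.adjoint_inner_left, ContinuousLinearMap.adjoint_inner_left,
    real_inner_comm, real_inner_comm (A (x k))] at hgrowthF
  rw [inner_neg_left, inner_neg_left] at hgrowthG
  have henergy : μF / 2 * ‖x k - xstar‖ ^ 2 + μG / 2 * ‖y k - ystar‖ ^ 2 ≤ energy k := by
    have hv₀ : 0 ≤ θ ^ 2 / (2 * r) * ‖v k - xstar‖ ^ 2 := by positivity
    have hu₀ : 0 ≤ θ ^ 2 / (2 * s) * ‖u k - ystar‖ ^ 2 := by positivity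
    simp only [energy, hL]
    linarith
  rw [div_mul_eq_mul_div, le_div_iff₀ (lt_min hμF hμG)]
  have hminF := mul_le_mul_of_nonneg_right (min_le_left μF μG) (sq_nonneg ‖x k - xstar‖)
  have hminG := mul_le_mul_of_nonneg_right (min_le_right μF μG) (sq_nonneg ‖y k - ystar‖)
  linarith [hdecay k hk]
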